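/- Let K be a nonempty compact topological space and let F : K × ℝ → ℝ be continuous. Suppose that for each x ∈ K the function t ↦ F(x, t) is differentiable, and the derivative ∂F/∂t : K × ℝ → ℝ is continuous. Define m(t) = min_{x ∈ K} F(x, t). Then for every t ∈ ℝ, the lower right Dini derivative of m at t satisfies liminf_{h → 0⁺} (m(t+h) − m(t))/h ≥ min { ∂F/∂t(x, t) : x ∈ K and F(x, t) = m(t) }. -/

import Mathlib

open Filter Set

/-- Around any `x`, for small positive `h`, the function `F (·, t + h)` stays above `b + c * h`,
provided `b` bounds `F (·, t)` from below and `c < F' (x, t)` if equality is attained at `x`. -/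
theorem eventually_add_mul_le_of_lt_deriv {K : Type*} [TopologicalSpace K] {F F' : K × ℝ → ℝ}
    (hF : Continuous F) (hF' : Continuous F')
    (hderiv : ∀ (x : K) (t : ℝ), HasDerivAt (fun s : ℝ => F (x, s)) (F' (x, t)) t)
    {t b c : ℝ} (hb : ∀ y, b ≤ F (y, t)) {x : K} (hc : F (x, t) = b → c < F' (x, t)) :
    ∀ᶠ z : ℝ × K in nhds (0, x), 0 < z.1 → b + c * z.1 ≤ F (z.2, t + z.1) := by
  rcases (hb x).eq_or_lt with hx | hx
  · have hev : ∀ᶠ z : ℝ × K in nhds (0, x), c < F' (z.2, t + z.1) := by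
      have hcont : Continuous fun z : ℝ × K => F' (z.2, t + z.1) := by fun_prop
      exact hcont.continuousAt.eventually_const_lt (by simpa using hc hx.symm)
    rw [nhds_prod_eq, eventually_prod_iff] at hev ⊢
    obtain ⟨p, hp, q, hq, hpq⟩ := hev
    obtain ⟨δ, hδ, hpδ⟩ := Metric.eventually_nhds_iff.1 hp
    refine ⟨fun h => dist h 0 < δ, Metric.ball_mem_nhds _ hδ, q, hq, fun {h} hh y hy hpos => ?_⟩
    obtain ⟨s, hs, hslope⟩ := exists_hasDerivAt_eq_slope (fun s : ℝ => F (y, s))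
      (fun s => F' (y, s)) (by linarith : t < t + h) (by fun_prop) (fun s _ => hderiv y s)
    have hps : p (s - t) := hpδ <| by
      beta_reduce at hh
      rw [Real.dist_eq, sub_zero, abs_of_pos hpos] at hh
      rw [Real.dist_eq, sub_zero, abs_of_pos (sub_pos.2 hs.1)]
      linarith [hs.2]
    have hlt : c < F' (y, s) := by simpa using hpq hps hy
    rw [hslope, add_sub_cancel_left, lt_div_iff₀ hpos] at hlt
    linarith [hb y]
  · have hcont : Continuous fun z : ℝ × K => F (z.2, t + z.1) - c * z.1 := by fun_prop
    filter_upwards [hcont.continuousAt.eventually_const_lt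
      (show b < F (x, t + 0) - c * 0 by simpa using hx)] with z hz _
    linarith

/-- Hamilton's trick: for a continuous family `F : K × ℝ → ℝ` over a nonempty
compact space `K`, differentiable in time with continuous time-derivative `F'`,
the minimum `m t = min_{x ∈ K} F (x, t)` has its lower right Dini derivative
bounded below by the minimum of `F' (x, t)` over the minimizers `x`. -/
theorem dini_deriv_min_ge_min_deriv_at_minimizers
    {K : Type*} [TopologicalSpace K] [CompactSpace K] [Nonempty K]
    (F F' : K × ℝ → ℝ)
    (hF : Continuous F)
    (hF' : Continuous F')
    (hderiv : ∀ (x : K) (t : ℝ), HasDerivAt (fun s : ℝ => F (x, s)) (F' (x, t)) t)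
    (m : ℝ → ℝ) (hm : ∀ t : ℝ, IsLeast ((fun x : K => F (x, t)) '' univ) (m t)) :
    ∀ t : ℝ,
      sInf {y : ℝ | ∃ x : K, F (x, t) = m t ∧ F' (x, t) = y} ≤
        liminf (fun h : ℝ => (m (t + h) - m t) / h) (nhdsWithin 0 (Ioi 0)) := by
  intro t
  have hle : ∀ s y, m s ≤ F (y, s) := fun s y => (hm s).2 ⟨y, mem_univ y, rfl⟩
  obtain ⟨x₀, -, hx₀⟩ := (hm t).1
  have hbdd : BddBelow {y : ℝ | ∃ x : K, F (x, t) = m t ∧ F' (x, t) = y} := by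
    refine (isCompact_range (f := fun x : K => F' (x, t)) (by fun_prop)).bddBelow.mono ?_
    rintro _ ⟨x, -, rfl⟩
    exact mem_range_self x
  have hcobdd : IsCoboundedUnder (· ≥ ·) (nhdsWithin 0 (Ioi 0))
      (fun h : ℝ => (m (t + h) - m t) / h) := by
    have hslope := (hderiv x₀ t).tendsto_slope_zero_right
    refine IsBoundedUnder.isCoboundedUnder_ge (hslope.isBoundedUnder_le.mono_le ?_)
    filter_upwards [self_mem_nhdsWithin] with h hpos
    rw [smul_eq_mul, ← div_eq_inv_mul]
    exact div_le_div_of_nonneg_right (sub_le_sub (hle _ x₀) hx₀.le) (mem_Ioi.1 hpos).le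
  refine le_of_forall_lt_imp_le_of_dense fun c hc => le_liminf_of_le hcobdd ?_
  have hev := isCompact_univ.eventually_forall_of_forall_eventually
    (P := fun h y => 0 < h → m t + c * h ≤ F (y, t + h)) fun x _ =>
    eventually_add_mul_le_of_lt_deriv (x := x) hF hF' hderiv (hle t)
      fun hx => hc.trans_le (csInf_le hbdd ⟨x, hx, rfl⟩)
  filter_upwards [hev.filter_mono nhdsWithin_le_nhds, self_mem_nhdsWithin] with h hh hpos
  obtain ⟨y, -, hy⟩ := (hm (t + h)).1
  rw [le_div_iff₀ hpos, ← hy]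
  linarith [hh y (mem_univ y) hpos]
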